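/- Conservation law for Tétrode's energy-momentum tensor: under the right-spinor Dirac setup, with G_{μν} := ∂_μΓ_ν - ∂_νΓ_μ, one has Σ_{μ=0}^{3} ∂_μ T_ν^μ = Σ_{μ=0}^{3} G_{μν}·j^μ on ℝ⁴, for every ν ∈ {0,1,2,3}. -/

import Mathlib

open Matrix

noncomputable section

/-- The space algebra `Cl(3)` represented as `M₂(ℂ)`. -/
abbrev M2 : Type := Matrix (Fin 2) (Fin 2) ℂ

/-- Spacetime `ℝ⁴`. -/
abbrev R4 : Type := Fin 4 → ℝ

/-- Basis paravectors: `e 0 = 1` and the Pauli matrices. -/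
def e : Fin 4 → M2 :=
  ![1, !![0, 1; 1, 0], !![0, -Complex.I; Complex.I, 0], !![1, 0; 0, -1]]

/-- Dual basis paravectors: `edual 0 = 1` and `edual k = - e k` for `k = 1,2,3`. -/
def edual : Fin 4 → M2 :=
  ![1, -e 1, -e 2, -e 3]

/-- The grade automorphism `M̂ = (adj M)†`. -/
def gradeAut (M : M2) : M2 := (M.adjugate)ᴴ

/-- The projector `P = ½(1+e₃)`. -/
def P : M2 := !![1, 0; 0, 0]

/-- The projector `P̄ = ½(1-e₃)`. -/
def Pbar : M2 := !![0, 0; 0, 1]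

/-- Partial derivative `∂_μ` of a complex-valued function on `ℝ⁴`. -/
def pdC (μ : Fin 4) (f : R4 → ℂ) (x : R4) : ℂ := fderiv ℝ f x (Pi.single μ 1)

/-- Partial derivative `∂_μ` of a real-valued function on `ℝ⁴`. -/
def pdR (μ : Fin 4) (f : R4 → ℝ) (x : R4) : ℝ := fderiv ℝ f x (Pi.single μ 1)

/-- Entrywise partial derivative `∂_μ` of an `M₂(ℂ)`-valued function on `ℝ⁴`. -/
def pdM (μ : Fin 4) (f : R4 → M2) (x : R4) : M2 :=
  Matrix.of fun i j => pdC μ (fun y => f y i j) x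

/-- Components of the chiral current `𝔧 = φ·P̄·φ†`: `j^μ = ½ tr(𝔧 * e μ)`
(note `e 0 = 1`). -/
def jComp (φ : R4 → M2) (μ : Fin 4) (x : R4) : ℂ :=
  (1/2) * (φ x * Pbar * (φ x)ᴴ * e μ).trace

/-- Tétrode's energy-momentum tensor `T_ν^μ`. -/
def TComp (Γ : Fin 4 → R4 → ℝ) (φ : R4 → M2) (ν μ : Fin 4) (x : R4) : ℂ :=
  -(Complex.I / 4) *
      (edual μ *
        (pdM ν (fun y => gradeAut (φ y)) x * P * (φ x).adjugate
          - gradeAut (φ x) * P * pdM ν (fun y => (φ y).adjugate) x)).trace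
    + (Γ ν x : ℂ) * jComp φ μ x

/-- The Levi-Civita symbol on `{1,2,3}` (indexed by `Fin 3`), with `ε 0 1 2 = 1`. -/
def eps : Fin 3 → Fin 3 → Fin 3 → ℝ := fun i j k =>
  if (i, j, k) = (0, 1, 2) ∨ (i, j, k) = (1, 2, 0) ∨ (i, j, k) = (2, 0, 1) then 1
  else if (i, j, k) = (2, 1, 0) ∨ (i, j, k) = (1, 0, 2) ∨ (i, j, k) = (0, 2, 1) then -1
  else 0

theorem pdC_add' {f g : R4 → ℂ} (hf : ContDiff ℝ (⊤ : ℕ∞) f) (hg : ContDiff ℝ (⊤ : ℕ∞) g)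
    (μ : Fin 4) (x : R4) : pdC μ (fun y => f y + g y) x = pdC μ f x + pdC μ g x := by
  have h1 : DifferentiableAt ℝ f x := (hf.differentiable (by simp)) x
  have h2 : DifferentiableAt ℝ g x := (hg.differentiable (by simp)) x
  unfold pdC
  rw [fderiv_fun_add h1 h2]; rfl

theorem pdC_sub' {f g : R4 → ℂ} (hf : ContDiff ℝ (⊤ : ℕ∞) f) (hg : ContDiff ℝ (⊤ : ℕ∞) g)
    (μ : Fin 4) (x : R4) : pdC μ (fun y => f y - g y) x = pdC μ f x - pdC μ g x := by
  have h1 : DifferentiableAt ℝ f x := (hf.differentiable (by simp)) x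
  have h2 : DifferentiableAt ℝ g x := (hg.differentiable (by simp)) x
  unfold pdC
  rw [fderiv_fun_sub h1 h2]; rfl

theorem pdC_mul' {f g : R4 → ℂ} (hf : ContDiff ℝ (⊤ : ℕ∞) f) (hg : ContDiff ℝ (⊤ : ℕ∞) g)
    (μ : Fin 4) (x : R4) : pdC μ (fun y => f y * g y) x = pdC μ f x * g x + f x * pdC μ g x := by
  have h1 : DifferentiableAt ℝ f x := (hf.differentiable (by simp)) x
  have h2 : DifferentiableAt ℝ g x := (hg.differentiable (by simp)) x
  unfold pdC
  rw [fderiv_fun_mul h1 h2]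
  simp; ring

theorem pdC_const' (c : ℂ) (μ : Fin 4) (x : R4) : pdC μ (fun _ => c) x = 0 := by
  simp [pdC]

theorem pdC_neg' (f : R4 → ℂ) (μ : Fin 4) (x : R4) :
    pdC μ (fun y => - f y) x = - pdC μ f x := by
  unfold pdC
  rw [fderiv_fun_neg]; rfl

theorem pdC_conj' {f : R4 → ℂ} (hf : ContDiff ℝ (⊤ : ℕ∞) f) (μ : Fin 4) (x : R4) :
    pdC μ (fun y => (starRingEnd ℂ) (f y)) x = (starRingEnd ℂ) (pdC μ f x) := by
  have h1 : DifferentiableAt ℝ f x := (hf.differentiable (by simp)) x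
  have h2 := (Complex.conjCLE.toContinuousLinearMap.hasFDerivAt (x := f x)).comp x h1.hasFDerivAt
  unfold pdC
  have h3 : HasFDerivAt (fun y => (starRingEnd ℂ) (f y))
    (Complex.conjCLE.toContinuousLinearMap.comp (fderiv ℝ f x)) x := h2
  rw [h3.fderiv]
  simp

theorem pdC_ofReal' {f : R4 → ℝ} (hf : ContDiff ℝ (⊤ : ℕ∞) f) (μ : Fin 4) (x : R4) :
    pdC μ (fun y => (f y : ℂ)) x = (pdR μ f x : ℂ) := by
  have h1 : DifferentiableAt ℝ f x := (hf.differentiable (by simp)) x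
  have h2 := (Complex.ofRealCLM.hasFDerivAt (x := f x)).comp x h1.hasFDerivAt
  unfold pdC pdR
  have h3 : HasFDerivAt (fun y => (f y : ℂ))
    (Complex.ofRealCLM.comp (fderiv ℝ f x)) x := h2
  rw [h3.fderiv]
  simp

theorem contDiff_conj' {f : R4 → ℂ} (hf : ContDiff ℝ (⊤ : ℕ∞) f) :
    ContDiff ℝ (⊤ : ℕ∞) (fun y => (starRingEnd ℂ) (f y)) :=
  Complex.conjCLE.toContinuousLinearMap.contDiff.comp hf

theorem contDiff_ofReal' {f : R4 → ℝ} (hf : ContDiff ℝ (⊤ : ℕ∞) f) :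
    ContDiff ℝ (⊤ : ℕ∞) (fun y => (f y : ℂ)) :=
  Complex.ofRealCLM.contDiff.comp hf

theorem contDiff_pdC' {f : R4 → ℂ} (hf : ContDiff ℝ (⊤ : ℕ∞) f) (μ : Fin 4) :
    ContDiff ℝ (⊤ : ℕ∞) (fun y => pdC μ f y) := by
  unfold pdC
  exact (hf.fderiv_right (m := (⊤ : ℕ∞)) (by simp)).clm_apply contDiff_const

theorem pdC_comm' {f : R4 → ℂ} (hf : ContDiff ℝ (⊤ : ℕ∞) f) (μ ν : Fin 4) (x : R4) :
    pdC μ (fun y => pdC ν f y) x = pdC ν (fun y => pdC μ f y) x := by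
  have hd : DifferentiableAt ℝ (fderiv ℝ f) x :=
    ((hf.fderiv_right (m := (⊤ : ℕ∞)) (by simp)).differentiable (by simp)) x
  have hs : IsSymmSndFDerivAt ℝ f x :=
    (hf.contDiffAt).isSymmSndFDerivAt (by simp only [minSmoothness_of_isRCLikeNormedField]; exact WithTop.coe_le_coe.2 le_top)
  have key : ∀ a b : Fin 4, pdC a (fun y => pdC b f y) x
      = fderiv ℝ (fderiv ℝ f) x (Pi.single a 1) (Pi.single b 1) := by
    intro a b
    unfold pdC
    rw [fderiv_clm_apply hd (differentiableAt_const _)]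
    simp
  rw [key, key]
  exact hs _ _

/-- One bilinear piece of the tensor. -/
theorem pdC_piece {p q G : R4 → ℂ} (hp : ContDiff ℝ (⊤ : ℕ∞) p) (hq : ContDiff ℝ (⊤ : ℕ∞) q)
    (hG : ContDiff ℝ (⊤ : ℕ∞) G) (μ ν : Fin 4) (x : R4) :
    pdC μ (fun y => -(Complex.I / 4) * (p y * pdC ν q y - pdC ν p y * q y)
        + G y * ((1/2) * (p y * q y))) x
      = -(Complex.I / 4) * (pdC μ p x * pdC ν q x + p x * pdC ν (fun y => pdC μ q y) x
          - pdC ν (fun y => pdC μ p y) x * q x - pdC ν p x * pdC μ q x)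
        + pdC μ G x * ((1/2) * (p x * q x))
        + G x * ((1/2) * (pdC μ p x * q x + p x * pdC μ q x)) := by
  have hp' := contDiff_pdC' hp ν
  have hq' := contDiff_pdC' hq ν
  rw [pdC_add' (by fun_prop) (by fun_prop), pdC_mul' (by fun_prop) (by fun_prop),
    pdC_sub' (by fun_prop) (by fun_prop), pdC_mul' hp hq', pdC_mul' hp' hq,
    pdC_mul' hG (by fun_prop), pdC_mul' (by fun_prop) (by fun_prop), pdC_mul' hp hq,
    pdC_const', pdC_const', pdC_comm' hp μ ν, pdC_comm' hq μ ν]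
  ring

theorem pdC_comb {F : Fin 2 → Fin 2 → R4 → ℂ} (hF : ∀ i j, ContDiff ℝ (⊤ : ℕ∞) (F i j))
    (c : Fin 2 → Fin 2 → ℂ) (μ : Fin 4) (x : R4) :
    pdC μ (fun y => c 0 0 * F 0 0 y + c 0 1 * F 0 1 y + c 1 0 * F 1 0 y + c 1 1 * F 1 1 y) x
      = c 0 0 * pdC μ (F 0 0) x + c 0 1 * pdC μ (F 0 1) x + c 1 0 * pdC μ (F 1 0) x
        + c 1 1 * pdC μ (F 1 1) x := by
  have h00 := hF 0 0
  have h01 := hF 0 1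
  have h10 := hF 1 0
  have h11 := hF 1 1
  rw [pdC_add' (by fun_prop) (by fun_prop), pdC_add' (by fun_prop) (by fun_prop),
    pdC_add' (by fun_prop) (by fun_prop), pdC_mul' (by fun_prop) h00,
    pdC_mul' (by fun_prop) h01, pdC_mul' (by fun_prop) h10, pdC_mul' (by fun_prop) h11]
  simp only [pdC_const']
  ring

/-- the row spinor -/
def wsp (φ : R4 → M2) (i : Fin 2) (y : R4) : ℂ := if i = 0 then φ y 1 1 else - φ y 0 1

/-- the column spinor -/
def usp (φ : R4 → M2) (i : Fin 2) (y : R4) : ℂ := (starRingEnd ℂ) (wsp φ i y)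

def piece (Γ : Fin 4 → R4 → ℝ) (φ : R4 → M2) (ν : Fin 4) (i j : Fin 2) (y : R4) : ℂ :=
  -(Complex.I / 4) * (wsp φ i y * pdC ν (usp φ j) y - pdC ν (wsp φ i) y * usp φ j y)
        + (Γ ν y : ℂ) * ((1/2) * (wsp φ i y * usp φ j y))

theorem TComp_eq (Γ : Fin 4 → R4 → ℝ) (φ : R4 → M2) (ν μ : Fin 4) (y : R4) :
    TComp Γ φ ν μ y = edual μ 0 0 * piece Γ φ ν 0 0 y + edual μ 0 1 * piece Γ φ ν 0 1 y
      + edual μ 1 0 * piece Γ φ ν 1 0 y + edual μ 1 1 * piece Γ φ ν 1 1 y := by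
  have w0 : wsp φ 0 = fun y => φ y 1 1 := by ext y; simp [wsp]
  have w1 : wsp φ 1 = fun y => - φ y 0 1 := by ext y; simp [wsp]
  have u0 : usp φ 0 = fun y => (starRingEnd ℂ) (φ y 1 1) := by ext y; simp [usp, wsp]
  have u1 : usp φ 1 = fun y => - (starRingEnd ℂ) (φ y 0 1) := by ext y; simp [usp, wsp]
  simp only [piece, w0, w1, u0, u1]
  fin_cases μ <;>
  simp [TComp, jComp, edual, e, gradeAut, P, Pbar, pdM, Matrix.trace, Matrix.mul_apply,
    Fin.sum_univ_two, Matrix.adjugate_fin_two, pdC_neg', Matrix.vecMul, dotProduct] <;>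
  ring

theorem jComp_eq (φ : R4 → M2) (μ : Fin 4) (y : R4) :
    jComp φ μ y = (1/2) * (edual μ 0 0 * (wsp φ 0 y * usp φ 0 y) + edual μ 0 1 * (wsp φ 0 y * usp φ 1 y)
      + edual μ 1 0 * (wsp φ 1 y * usp φ 0 y) + edual μ 1 1 * (wsp φ 1 y * usp φ 1 y)) := by
  fin_cases μ <;>
  simp [jComp, edual, e, Pbar, Matrix.trace, Matrix.mul_apply, wsp, usp,
    Fin.sum_univ_two] <;>
  ring

/-- Conservation law for Tétrode's energy-momentum tensor:
`∂_μ T_ν^μ = G_{μν} j^μ` with `G_{μν} = ∂_μΓ_ν - ∂_νΓ_μ`. -/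
theorem energy_momentum_conservation
    (Γ : Fin 4 → R4 → ℝ) (hΓ : ∀ μ, ContDiff ℝ (⊤ : ℕ∞) (Γ μ))
    (φ : R4 → M2) (hφ : ∀ i j, ContDiff ℝ (⊤ : ℕ∞) (fun x => φ x i j))
    (hDirac : ∀ x : R4,
      (∑ μ : Fin 4, edual μ * pdM μ (fun y => gradeAut (φ y) * P) x)
        + Complex.I • ((∑ μ : Fin 4, (Γ μ x : ℂ) • edual μ) * (gradeAut (φ x) * P)) = 0) :
    ∀ ν : Fin 4, ∀ x : R4,
      ∑ μ : Fin 4, pdC μ (fun y => TComp Γ φ ν μ y) x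
        = ∑ μ : Fin 4, ((pdR μ (Γ ν) x - pdR ν (Γ μ) x : ℝ) : ℂ) * jComp φ μ x := by
  have hw : ∀ i, ContDiff ℝ (⊤ : ℕ∞) (wsp φ i) := by
    intro i
    fin_cases i
    · have : wsp φ 0 = fun y => φ y 1 1 := by ext y; simp [wsp]
      exact this ▸ hφ 1 1
    · have : wsp φ 1 = fun y => - φ y 0 1 := by ext y; simp [wsp]
      exact this ▸ (hφ 0 1).neg
  have hu : ∀ i, ContDiff ℝ (⊤ : ℕ∞) (usp φ i) := fun i => contDiff_conj' (hw i)
  have hG : ∀ μ, ContDiff ℝ (⊤ : ℕ∞) (fun y => (Γ μ y : ℂ)) := fun μ => contDiff_ofReal' (hΓ μ)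
  have hcw : ∀ i y, (starRingEnd ℂ) (usp φ i y) = wsp φ i y := by simp [usp]
  have hcu : ∀ i μ y, (starRingEnd ℂ) (pdC μ (usp φ i) y) = pdC μ (wsp φ i) y := by
    intro i μ y
    have := pdC_conj' (hw i) μ y
    change pdC μ (usp φ i) y = _ at this
    rw [this]; simp
  have hmat : ∀ y, gradeAut (φ y) * P = !![usp φ 0 y, 0; usp φ 1 y, 0] := by
    intro y
    ext i j
    fin_cases i <;> fin_cases j <;>
      simp [gradeAut, P, usp, wsp, Matrix.mul_apply, Fin.sum_univ_two, Matrix.adjugate_fin_two]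
  have hpdm : ∀ μ y, pdM μ (fun y => !![usp φ 0 y, 0; usp φ 1 y, 0]) y
      = !![pdC μ (usp φ 0) y, 0; pdC μ (usp φ 1) y, 0] := by
    intro μ y
    ext i j
    fin_cases i <;> fin_cases j <;> simp [pdM, pdC_const']
  have D0 : ∀ y, pdC 0 (usp φ 0) y - pdC 1 (usp φ 1) y + Complex.I * pdC 2 (usp φ 1) y
      - pdC 3 (usp φ 0) y + Complex.I * ((Γ 0 y : ℂ) * usp φ 0 y - (Γ 1 y : ℂ) * usp φ 1 y
        + Complex.I * ((Γ 2 y : ℂ) * usp φ 1 y) - (Γ 3 y : ℂ) * usp φ 0 y) = 0 := by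
    intro y
    have h := congrFun (congrFun (hDirac y) 0) 0
    simp only [hmat, hpdm] at h
    simp [edual, e, Fin.sum_univ_four, Matrix.mul_apply, Fin.sum_univ_two] at h
    linear_combination h
  have D1 : ∀ y, pdC 0 (usp φ 1) y - pdC 1 (usp φ 0) y - Complex.I * pdC 2 (usp φ 0) y
      + pdC 3 (usp φ 1) y + Complex.I * ((Γ 0 y : ℂ) * usp φ 1 y - (Γ 1 y : ℂ) * usp φ 0 y
        - Complex.I * ((Γ 2 y : ℂ) * usp φ 0 y) + (Γ 3 y : ℂ) * usp φ 1 y) = 0 := by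
    intro y
    have h := congrFun (congrFun (hDirac y) 1) 0
    simp only [hmat, hpdm] at h
    simp [edual, e, Fin.sum_univ_four, Matrix.mul_apply, Fin.sum_univ_two] at h
    linear_combination h
  have C0 : ∀ y, pdC 0 (wsp φ 0) y - pdC 1 (wsp φ 1) y - Complex.I * pdC 2 (wsp φ 1) y
      - pdC 3 (wsp φ 0) y - Complex.I * ((Γ 0 y : ℂ) * wsp φ 0 y - (Γ 1 y : ℂ) * wsp φ 1 y
        - Complex.I * ((Γ 2 y : ℂ) * wsp φ 1 y) - (Γ 3 y : ℂ) * wsp φ 0 y) = 0 := by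
    intro y
    have h := congrArg (starRingEnd ℂ) (D0 y)
    simp only [map_add, map_sub, map_mul, hcu, hcw, Complex.conj_I, Complex.conj_ofReal,
      map_zero] at h
    linear_combination h
  have C1 : ∀ y, pdC 0 (wsp φ 1) y - pdC 1 (wsp φ 0) y + Complex.I * pdC 2 (wsp φ 0) y
      + pdC 3 (wsp φ 1) y - Complex.I * ((Γ 0 y : ℂ) * wsp φ 1 y - (Γ 1 y : ℂ) * wsp φ 0 y
        + Complex.I * ((Γ 2 y : ℂ) * wsp φ 0 y) + (Γ 3 y : ℂ) * wsp φ 1 y) = 0 := by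
    intro y
    have h := congrArg (starRingEnd ℂ) (D1 y)
    simp only [map_add, map_sub, map_mul, hcu, hcw, Complex.conj_I, Complex.conj_ofReal,
      map_zero] at h
    linear_combination h
  intro ν x
  have hpu := fun i μ => contDiff_pdC' (hu i) μ
  have hpw := fun i μ => contDiff_pdC' (hw i) μ
  -- generic differentiated Dirac row
  have gen : ∀ (p q : R4 → ℂ) (_ : ContDiff ℝ (⊤ : ℕ∞) p) (_ : ContDiff ℝ (⊤ : ℕ∞) q)
      (s c k : ℂ) (_ : ∀ y, pdC 0 p y - pdC 1 q y + c * pdC 2 q y + s * pdC 3 p y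
        + k * ((Γ 0 y : ℂ) * p y - (Γ 1 y : ℂ) * q y
        + c * ((Γ 2 y : ℂ) * q y) + s * ((Γ 3 y : ℂ) * p y)) = 0),
      pdC ν (fun y => pdC 0 p y) x - pdC ν (fun y => pdC 1 q y) x
        + c * pdC ν (fun y => pdC 2 q y) x + s * pdC ν (fun y => pdC 3 p y) x
        + k * ((pdR ν (Γ 0) x : ℂ) * p x + (Γ 0 x : ℂ) * pdC ν p x
          - ((pdR ν (Γ 1) x : ℂ) * q x + (Γ 1 x : ℂ) * pdC ν q x)
          + c * ((pdR ν (Γ 2) x : ℂ) * q x + (Γ 2 x : ℂ) * pdC ν q x)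
          + s * ((pdR ν (Γ 3) x : ℂ) * p x + (Γ 3 x : ℂ) * pdC ν p x)) = 0 := by
    intro p q hp hq s c k h
    have hp' := fun μ => contDiff_pdC' hp μ
    have hq' := fun μ => contDiff_pdC' hq μ
    have h0 := hG 0
    have h1 := hG 1
    have h2 := hG 2
    have h3 := hG 3
    have hp0 := hp' 0
    have hq1 := hq' 1
    have hq2 := hq' 2
    have hp3 := hp' 3
    have hz := congrArg (fun f => pdC ν f x) (funext h)
    simp only [pdC_const'] at hz
    rw [pdC_add' (by fun_prop) (by fun_prop), pdC_add' (by fun_prop) (by fun_prop),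
      pdC_add' (by fun_prop) (by fun_prop), pdC_sub' (by fun_prop) (by fun_prop),
      pdC_mul' (by fun_prop) hq2, pdC_mul' (by fun_prop) hp3,
      pdC_mul' (by fun_prop) (by fun_prop),
      pdC_add' (by fun_prop) (by fun_prop),
      pdC_add' (by fun_prop) (by fun_prop), pdC_sub' (by fun_prop) (by fun_prop),
      pdC_mul' h0 hp, pdC_mul' h1 hq, pdC_mul' (by fun_prop) (by fun_prop),
      pdC_mul' h2 hq, pdC_mul' (by fun_prop) (by fun_prop), pdC_mul' h3 hp,
      pdC_ofReal' (hΓ 0), pdC_ofReal' (hΓ 1), pdC_ofReal' (hΓ 2), pdC_ofReal' (hΓ 3)] at hz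
    simp only [pdC_const'] at hz
    linear_combination hz
  have E0 := gen (usp φ 0) (usp φ 1) (hu 0) (hu 1) (-1) Complex.I Complex.I
    (fun y => by linear_combination D0 y)
  have E1 := gen (usp φ 1) (usp φ 0) (hu 1) (hu 0) 1 (-Complex.I) Complex.I
    (fun y => by linear_combination D1 y)
  have F0 := gen (wsp φ 0) (wsp φ 1) (hw 0) (hw 1) (-1) (-Complex.I) (-Complex.I)
    (fun y => by linear_combination C0 y)
  have F1 := gen (wsp φ 1) (wsp φ 0) (hw 1) (hw 0) 1 Complex.I (-Complex.I)
    (fun y => by linear_combination C1 y)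
  have hpiece : ∀ i j, ContDiff ℝ (⊤ : ℕ∞) (piece Γ φ ν i j) := by
    intro i j
    have h1 := hpu j ν
    have h2 := hpw i ν
    have h3 := hu j
    have h4 := hw i
    have h5 := hG ν
    unfold piece
    fun_prop
  have hpd : ∀ i j μ, pdC μ (piece Γ φ ν i j) x = _ := fun i j μ =>
    pdC_piece (hw i) (hu j) (hG ν) μ ν x
  have hT : ∀ μ, pdC μ (fun y => TComp Γ φ ν μ y) x = _ := fun μ => by
    simp only [TComp_eq]
    exact pdC_comb hpiece (edual μ) μ x
  simp only [hT, hpd, jComp_eq, Fin.sum_univ_four, pdC_ofReal' (hΓ ν)]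
  have d0 := D0 x
  have d1 := D1 x
  have c0 := C0 x
  have c1 := C1 x
  clear hT hpd hpiece gen D0 D1 C0 C1 hDirac
  simp [edual, e]
  have hI := Complex.I_sq
  generalize Complex.I = I at *
  linear_combination (-(I/4)) * (wsp φ 0 x * E0 + wsp φ 1 x * E1 - usp φ 0 x * F0 - usp φ 1 x * F1
    + c0 * pdC ν (usp φ 0) x + c1 * pdC ν (usp φ 1) x
    - d0 * pdC ν (wsp φ 0) x - d1 * pdC ν (wsp φ 1) x)
    + (Γ ν x : ℂ) / 2 * (wsp φ 0 x * d0 + wsp φ 1 x * d1 + usp φ 0 x * c0 + usp φ 1 x * c1)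
    + hI * (1/2) * (wsp φ 0 x * usp φ 0 x * ((pdR ν (Γ 0) x : ℂ) - (pdR ν (Γ 3) x : ℂ))
      + wsp φ 1 x * usp φ 1 x * ((pdR ν (Γ 0) x : ℂ) + (pdR ν (Γ 3) x : ℂ))
      - (wsp φ 0 x * usp φ 1 x + wsp φ 1 x * usp φ 0 x) * (pdR ν (Γ 1) x : ℂ)
      + I * (pdR ν (Γ 2) x : ℂ) * (wsp φ 0 x * usp φ 1 x - wsp φ 1 x * usp φ 0 x))
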